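/- arXiv:1003.4137 — 2 statements merged into one kernel-verified Lean document; each statement's English description precedes it below -/
import Mathlib

section
/- Let S⁰ be an adequate semigroup with semilattice of idempotents E⁰, L a left adequate semigroup and R a right adequate semigroup such that S⁰ is a quasi-ideal adequate transversal of both L and R, let ∗ : R × L → S⁰ satisfy conditions (1) and (2), and let T = {(x,a) ∈ L × R : x̄ = ā} with multiplication (x,a)(y,b) = (e_x(a∗y), (a∗y)f_b). Then E(T) = {(x,a) ∈ T : x̄ = a∗x}. -/
/-!
Common framework: "relative" semigroup-theoretic notions.  All notions are taken
relative to a carrier set `U` inside an ambient type, together with an explicit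
binary operation `mul` (only the values of `mul` on `U` are relevant).  For an
honest semigroup `S` one takes `U = Set.univ` and `mul = mulOf S`.

* `RStarOn mul U a b` : the relation `a ℛ* b` computed in `U` with an identity
  adjoined (the two clauses correspond to multipliers from `U` and to the
  adjoined identity).
* `LStarOn`, `GreenLOn`, `GreenROn` : dual / Green's relations.
* `AbundantOn`, `AdequateOn`, `LeftAdequateOn`, `RightAdequateOn`.
* `AdequateTransversalOn mul U S0` : `S0` is an adequate `*`-subsemigroup of `U`
  which is an adequate transversal, with the data `bar x = x̄`, `e x = e_x`,
  `f x = f_x`, and `plus s = s⁺`, `star s = s⋆` for `s ∈ S0`.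
* `InverseTransversalOn mul U S0` : `S0` is an inverse transversal of the
  regular semigroup `U`, with `o x = x⁰` the unique inverse of `x` in `S0`.
-/

namespace Paper

universe u

variable {α : Type*} {β : Type*} {γ : Type*}

def mulOf (α : Type*) [Mul α] : α → α → α := fun a b => a * b

/-- `x` is an idempotent for the operation `mul`. -/
def Idem (mul : α → α → α) (x : α) : Prop := mul x x = x

/-- The relation `ℛ*` on `U` (with an identity adjoined to `U`). -/
def RStarOn (mul : α → α → α) (U : Set α) (a b : α) : Prop :=
  (∀ x ∈ U, ∀ y ∈ U, (mul x a = mul y a ↔ mul x b = mul y b)) ∧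
  (∀ x ∈ U, (mul x a = a ↔ mul x b = b))

/-- The relation `ℒ*` on `U` (with an identity adjoined to `U`). -/
def LStarOn (mul : α → α → α) (U : Set α) (a b : α) : Prop :=
  (∀ x ∈ U, ∀ y ∈ U, (mul a x = mul a y ↔ mul b x = mul b y)) ∧
  (∀ x ∈ U, (mul a x = a ↔ mul b x = b))

/-- Green's relation `ℒ` on `U`: `U¹ a = U¹ b`. -/
def GreenLOn (mul : α → α → α) (U : Set α) (a b : α) : Prop :=
  (a = b ∨ ∃ u ∈ U, mul u b = a) ∧ (b = a ∨ ∃ v ∈ U, mul v a = b)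

/-- Green's relation `ℛ` on `U`: `a U¹ = b U¹`. -/
def GreenROn (mul : α → α → α) (U : Set α) (a b : α) : Prop :=
  (a = b ∨ ∃ u ∈ U, mul b u = a) ∧ (b = a ∨ ∃ v ∈ U, mul a v = b)

/-- `U` is closed under `mul`. -/
def ClosedOn (mul : α → α → α) (U : Set α) : Prop :=
  ∀ a ∈ U, ∀ b ∈ U, mul a b ∈ U

/-- `U` with the operation `mul` is a semigroup. -/
def SemigroupOn (mul : α → α → α) (U : Set α) : Prop :=
  ClosedOn mul U ∧ ∀ a ∈ U, ∀ b ∈ U, ∀ c ∈ U, mul (mul a b) c = mul a (mul b c)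

/-- Every `ℛ*`-class and every `ℒ*`-class of `U` contains an idempotent. -/
def AbundantOn (mul : α → α → α) (U : Set α) : Prop :=
  ∀ a ∈ U, (∃ e ∈ U, Idem mul e ∧ RStarOn mul U a e) ∧
           (∃ f ∈ U, Idem mul f ∧ LStarOn mul U a f)

/-- Abundant with commuting idempotents. -/
def AdequateOn (mul : α → α → α) (U : Set α) : Prop :=
  AbundantOn mul U ∧
    ∀ u ∈ U, ∀ v ∈ U, Idem mul u → Idem mul v → mul u v = mul v u

/-- Abundant, and every `ℛ*`-class contains a unique idempotent. -/
def LeftAdequateOn (mul : α → α → α) (U : Set α) : Prop :=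
  AbundantOn mul U ∧
    ∀ u ∈ U, ∀ v ∈ U, Idem mul u → Idem mul v → RStarOn mul U u v → u = v

/-- Abundant, and every `ℒ*`-class contains a unique idempotent. -/
def RightAdequateOn (mul : α → α → α) (U : Set α) : Prop :=
  AbundantOn mul U ∧
    ∀ u ∈ U, ∀ v ∈ U, Idem mul u → Idem mul v → LStarOn mul U u v → u = v

/-- `S0` is a quasi-ideal of `U` : `S0 U S0 ⊆ S0`. -/
def QuasiIdealOn (mul : α → α → α) (U S0 : Set α) : Prop :=
  ∀ s ∈ S0, ∀ x ∈ U, ∀ t ∈ S0, mul (mul s x) t ∈ S0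

/-- Every element of `U` has an inverse in `U`. -/
def RegularOn (mul : α → α → α) (U : Set α) : Prop :=
  ∀ x ∈ U, ∃ u ∈ U, mul (mul x u) x = x ∧ mul (mul u x) u = u

/-- Regular with commuting idempotents, i.e. an inverse semigroup. -/
def InverseSgpOn (mul : α → α → α) (U : Set α) : Prop :=
  RegularOn mul U ∧
    ∀ u ∈ U, ∀ v ∈ U, Idem mul u → Idem mul v → mul u v = mul v u

/-- Regular, and every Green `ℛ`-class contains a unique idempotent. -/
def LeftInverseSgpOn (mul : α → α → α) (U : Set α) : Prop :=
  RegularOn mul U ∧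
    ∀ u ∈ U, ∀ v ∈ U, Idem mul u → Idem mul v → GreenROn mul U u v → u = v

/-- Regular, and every Green `ℒ`-class contains a unique idempotent. -/
def RightInverseSgpOn (mul : α → α → α) (U : Set α) : Prop :=
  RegularOn mul U ∧
    ∀ u ∈ U, ∀ v ∈ U, Idem mul u → Idem mul v → GreenLOn mul U u v → u = v

/-- An isomorphism from `(A, mulA)` onto `(B, mulB)`. -/
def IsoOn (mulA : α → α → α) (mulB : β → β → β) (A : Set α) (B : Set β) : Prop :=
  ∃ θ : α → β, Set.BijOn θ A B ∧ ∀ a ∈ A, ∀ b ∈ A, θ (mulA a b) = mulB (θ a) (θ b)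

/-- `S0` is an adequate transversal of the abundant semigroup `U`.  `S0` is an
adequate `*`-subsemigroup of `U` (witnessed by `plus`/`star`, the canonical
idempotents `a⁺ ℛ* a`, `a⋆ ℒ* a` of elements of `S0`, the `ℛ*`/`ℒ*` relations
being those of the big semigroup `U`, which gives the `*`-subsemigroup property),
and every `x ∈ U` factors uniquely as `x = e_x x̄ f_x` with `x̄ ∈ S0`,
`e_x, f_x` idempotents of `U`, `e_x ℒ x̄⁺` and `f_x ℛ x̄⋆`. -/
structure AdequateTransversalOn (mul : α → α → α) (U S0 : Set α) where
  sub : S0 ⊆ U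
  mul_mem : ∀ a ∈ S0, ∀ b ∈ S0, mul a b ∈ S0
  bar : α → α
  e : α → α
  f : α → α
  plus : α → α
  star : α → α
  plus_mem : ∀ a ∈ S0, plus a ∈ S0
  plus_idem : ∀ a ∈ S0, Idem mul (plus a)
  plus_rstar : ∀ a ∈ S0, RStarOn mul U a (plus a)
  star_mem : ∀ a ∈ S0, star a ∈ S0
  star_idem : ∀ a ∈ S0, Idem mul (star a)
  star_lstar : ∀ a ∈ S0, LStarOn mul U a (star a)
  idem_comm : ∀ u ∈ S0, ∀ v ∈ S0, Idem mul u → Idem mul v → mul u v = mul v u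
  bar_mem : ∀ x ∈ U, bar x ∈ S0
  e_mem : ∀ x ∈ U, e x ∈ U
  f_mem : ∀ x ∈ U, f x ∈ U
  e_idem : ∀ x ∈ U, Idem mul (e x)
  f_idem : ∀ x ∈ U, Idem mul (f x)
  decomp : ∀ x ∈ U, x = mul (mul (e x) (bar x)) (f x)
  e_greenL : ∀ x ∈ U, GreenLOn mul U (e x) (plus (bar x))
  f_greenR : ∀ x ∈ U, GreenROn mul U (f x) (star (bar x))
  unique : ∀ x ∈ U, ∀ s ∈ S0, ∀ e' ∈ U, ∀ f' ∈ U, Idem mul e' → Idem mul f' →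
      x = mul (mul e' s) f' → GreenLOn mul U e' (plus s) → GreenROn mul U f' (star s) →
      s = bar x ∧ e' = e x ∧ f' = f x

namespace AdequateTransversalOn

variable {mul : α → α → α} {U S0 : Set α}

/-- `R = {x ∈ U : e_x = e_{x̄}}`. -/
def Rset (T : AdequateTransversalOn mul U S0) : Set α :=
  {x | x ∈ U ∧ T.e x = T.e (T.bar x)}

/-- `L = {x ∈ U : f_x = f_{x̄}}`. -/
def Lset (T : AdequateTransversalOn mul U S0) : Set α :=
  {x | x ∈ U ∧ T.f x = T.f (T.bar x)}

/-- `I = {e_x : x ∈ U}`. -/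
def Iset (T : AdequateTransversalOn mul U S0) : Set α :=
  {y | ∃ x ∈ U, T.e x = y}

/-- `Λ = {f_x : x ∈ U}`. -/
def LamSet (T : AdequateTransversalOn mul U S0) : Set α :=
  {y | ∃ x ∈ U, T.f x = y}

/-- The transversal is multiplicative: `Λ I ⊆ E⁰`. -/
def IsMultiplicative (T : AdequateTransversalOn mul U S0) : Prop :=
  ∀ l ∈ T.LamSet, ∀ i ∈ T.Iset, mul l i ∈ S0 ∧ Idem mul (mul l i)

end AdequateTransversalOn

/-- The spined product set `T = L |×| R ⊆ S × S` attached to an adequate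
transversal of `S` (ambient carrier `U`). -/
def spSet {mul : α → α → α} {U S0 : Set α}
    (T : AdequateTransversalOn mul U S0) : Set (α × α) :=
  {p | p.1 ∈ T.Lset ∧ p.2 ∈ T.Rset ∧ T.bar p.1 = T.bar p.2}

/-- The multiplication `(x,a)(y,b) = (e_x(ay), (ay) f_b)` on the spined product. -/
def spMul {mul : α → α → α} {U S0 : Set α}
    (T : AdequateTransversalOn mul U S0) : α × α → α × α → α × α :=
  fun p q => (mul (T.e p.1) (mul p.2 q.1), mul (mul p.2 q.1) (T.f q.2))

/-- The map `φ : S → T`, `x ↦ (e_x x̄, x̄ f_x)`. -/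
def phiMap {mul : α → α → α} {U S0 : Set α}
    (T : AdequateTransversalOn mul U S0) : α → α × α :=
  fun x => (mul (T.e x) (T.bar x), mul (T.bar x) (T.f x))

/-- `T⁰ = {(s,s) : s ∈ S0}`. -/
def diagSet (S0 : Set α) : Set (α × α) := {p | ∃ s ∈ S0, p = (s, s)}

/-- Abstract spined product `L |×| R` over a common transversal `S⁰` (a type `γ`
embedded into `L` and `R` by `jL`, `jR`). -/
def absTset {mulL : α → α → α} {mulR : β → β → β} {jL : γ → α} {jR : γ → β}
    (TL : AdequateTransversalOn mulL Set.univ (Set.range jL))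
    (TR : AdequateTransversalOn mulR Set.univ (Set.range jR)) : Set (α × β) :=
  {p | ∃ s : γ, jL s = TL.bar p.1 ∧ jR s = TR.bar p.2}

/-- The multiplication `(x,a)(y,b) = (e_x(a∗y), (a∗y) f_b)`. -/
def absMul {mulL : α → α → α} {mulR : β → β → β} {jL : γ → α} {jR : γ → β}
    (TL : AdequateTransversalOn mulL Set.univ (Set.range jL))
    (TR : AdequateTransversalOn mulR Set.univ (Set.range jR))
    (st : β → α → γ) : α × β → α × β → α × β :=
  fun p q => (mulL (TL.e p.1) (jL (st p.2 q.1)), mulR (jR (st p.2 q.1)) (TR.f q.2))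

/-- `T⁰ = {(s,s) : s ∈ S⁰}` inside `L × R`, where `s` is viewed in `L` and in `R`. -/
def absT0 (jL : γ → α) (jR : γ → β) : Set (α × β) :=
  {p | ∃ s : γ, p = (jL s, jR s)}

/-- `S0` is an inverse transversal of the regular semigroup `U`: an inverse
subsemigroup meeting the set of inverses of each `x ∈ U` in exactly one
element `o x = x⁰`. -/
structure InverseTransversalOn (mul : α → α → α) (U S0 : Set α) where
  sub : S0 ⊆ U
  mul_mem : ∀ a ∈ S0, ∀ b ∈ S0, mul a b ∈ S0
  o : α → α
  o_mem : ∀ x ∈ U, o x ∈ S0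
  o_inv1 : ∀ x ∈ U, mul (mul x (o x)) x = x
  o_inv2 : ∀ x ∈ U, mul (mul (o x) x) (o x) = o x
  o_unique : ∀ x ∈ U, ∀ u ∈ S0, mul (mul x u) x = x → mul (mul u x) u = u → u = o x
  idem_comm : ∀ u ∈ S0, ∀ v ∈ S0, Idem mul u → Idem mul v → mul u v = mul v u

namespace InverseTransversalOn

variable {mul : α → α → α} {U S0 : Set α}

/-- `L = {x ∈ U : x⁰x ∈ E⁰}`. -/
def LsetI (T : InverseTransversalOn mul U S0) : Set α :=
  {x | x ∈ U ∧ mul (T.o x) x ∈ S0 ∧ Idem mul (mul (T.o x) x)}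

/-- `R = {x ∈ U : xx⁰ ∈ E⁰}`. -/
def RsetI (T : InverseTransversalOn mul U S0) : Set α :=
  {x | x ∈ U ∧ mul x (T.o x) ∈ S0 ∧ Idem mul (mul x (T.o x))}

end InverseTransversalOn

/-- Spined product set for an inverse transversal: `{(x,a) : x⁰ = a⁰}`. -/
def invSpSet {mul : α → α → α} {U S0 : Set α}
    (T : InverseTransversalOn mul U S0) : Set (α × α) :=
  {p | p.1 ∈ T.LsetI ∧ p.2 ∈ T.RsetI ∧ T.o p.1 = T.o p.2}

/-- The multiplication `(x,a)(y,b) = ((xx⁰)(ay), (ay)(b⁰b))`. -/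
def invSpMul {mul : α → α → α} {U S0 : Set α}
    (T : InverseTransversalOn mul U S0) : α × α → α × α → α × α :=
  fun p q => (mul (mul p.1 (T.o p.1)) (mul p.2 q.1),
              mul (mul p.2 q.1) (mul (T.o q.2) q.2))

/-- Abstract spined product for inverse transversals: `{(x,a) : x⁰ = a⁰}`. -/
def invAbsTset {mulL : α → α → α} {mulR : β → β → β} {jL : γ → α} {jR : γ → β}
    (TL : InverseTransversalOn mulL Set.univ (Set.range jL))
    (TR : InverseTransversalOn mulR Set.univ (Set.range jR)) : Set (α × β) :=
  {p | ∃ s : γ, jL s = TL.o p.1 ∧ jR s = TR.o p.2}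

/-- The multiplication `(x,a)(y,b) = ((xx⁰)(a∗y), (a∗y)(b⁰b))`. -/
def invAbsMul {mulL : α → α → α} {mulR : β → β → β} {jL : γ → α} {jR : γ → β}
    (TL : InverseTransversalOn mulL Set.univ (Set.range jL))
    (TR : InverseTransversalOn mulR Set.univ (Set.range jR))
    (st : β → α → γ) : α × β → α × β → α × β :=
  fun p q => (mulL (mulL p.1 (TL.o p.1)) (jL (st p.2 q.1)),
              mulR (jR (st p.2 q.1)) (mulR (TR.o q.2) q.2))

/-- The multiplication `(e,x)(g,w) = (e(aa⁻¹), a)`, `a = x((x⁻¹x)g)w`, on `I × S⁰`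
(Chen-style construction from a left normal band `I` with semilattice transversal
`E⁰ = E(S⁰)`; `σ` embeds idempotents of the inverse semigroup `γ` into the band
`β`, and `π : β → γ` is the semilattice-transversal map `e ↦ e⁰`). -/
def bandMul (mulB : β → β → β) (mulG : γ → γ → γ) (σ : γ → β) (π : β → γ)
    (inv : γ → γ) (p q : β × γ) : β × γ :=
  let a := mulG (mulG p.2 (π (mulB (σ (mulG (inv p.2) p.2)) q.1))) q.2
  (mulB p.1 (σ (mulG a (inv a))), a)

/-- `T = {(e,x) : e⁰ = xx⁻¹}`. -/
def bandTset (mulG : γ → γ → γ) (π : β → γ) (inv : γ → γ) : Set (β × γ) :=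
  {p | π p.1 = mulG p.2 (inv p.2)}

/-- `T⁰ = {(aa⁻¹, a) : a ∈ S⁰}` (with `aa⁻¹` viewed in the band via `σ`). -/
def bandT0 (mulG : γ → γ → γ) (σ : γ → β) (inv : γ → γ) : Set (β × γ) :=
  {p | ∃ s : γ, p = (σ (mulG s (inv s)), s)}

end Paper

namespace Paper

section Semigroup

variable {S : Type*} [Semigroup S]

/-- Idempotents related by Green's `ℛ` are left identities for each other. -/
theorem GreenROn.mul_eq {e f : S} (h : GreenROn (mulOf S) Set.univ e f)
    (he : Idem (mulOf S) e) (hf : Idem (mulOf S) f) : e * f = f ∧ f * e = e := by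
  simp only [GreenROn, Idem, mulOf, Set.mem_univ, true_and] at *
  obtain ⟨rfl | ⟨u, rfl⟩, h₂⟩ := h
  · exact ⟨hf, hf⟩
  · refine ⟨?_, by rw [← mul_assoc, hf]⟩
    obtain h | ⟨v, hv⟩ := h₂
    · rw [← h, hf]
    · have h : f * u * (f * u * v) = f * u * v := by rw [← mul_assoc, he]
      rwa [hv] at h

/-- Idempotents related by Green's `ℒ` are right identities for each other. -/
theorem GreenLOn.mul_eq {e f : S} (h : GreenLOn (mulOf S) Set.univ e f)
    (he : Idem (mulOf S) e) (hf : Idem (mulOf S) f) : e * f = e ∧ f * e = f := by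
  simp only [GreenLOn, Idem, mulOf, Set.mem_univ, true_and] at *
  obtain ⟨rfl | ⟨u, rfl⟩, h₂⟩ := h
  · exact ⟨hf, hf⟩
  · refine ⟨by rw [mul_assoc, hf], ?_⟩
    obtain h | ⟨v, hv⟩ := h₂
    · rw [← h, hf]
    · have h : v * (u * f) * (u * f) = v * (u * f) := by rw [mul_assoc, he]
      rwa [hv] at h

theorem RStarOn.of_mul_eq {e f : S} (hef : e * f = f) (hfe : f * e = e) :
    RStarOn (mulOf S) Set.univ e f := by
  refine ⟨fun x _ y _ => ⟨fun h => ?_, fun h => ?_⟩, fun x _ => ⟨fun h => ?_, fun h => ?_⟩⟩ <;>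
    simp only [mulOf] at *
  · rw [← hef, ← mul_assoc, h, mul_assoc]
  · rw [← hfe, ← mul_assoc, h, mul_assoc]
  · rw [← hef, ← mul_assoc, h]
  · rw [← hfe, ← mul_assoc, h]

theorem LStarOn.of_mul_eq {e f : S} (hef : e * f = e) (hfe : f * e = f) :
    LStarOn (mulOf S) Set.univ e f := by
  refine ⟨fun x _ y _ => ⟨fun h => ?_, fun h => ?_⟩, fun x _ => ⟨fun h => ?_, fun h => ?_⟩⟩ <;>
    simp only [mulOf] at *
  · rw [← hfe, mul_assoc, h, mul_assoc]
  · rw [← hef, mul_assoc, h, mul_assoc]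
  · rw [← hfe, mul_assoc, h]
  · rw [← hef, mul_assoc, h]

namespace AdequateTransversalOn

variable {S0 : Set S} (T : AdequateTransversalOn (mulOf S) Set.univ S0)

theorem plus_mul {s : S} (hs : s ∈ S0) : T.plus s * s = s :=
  ((T.plus_rstar s hs).2 _ trivial).2 (T.plus_idem s hs)

theorem mul_star {s : S} (hs : s ∈ S0) : s * T.star s = s :=
  ((T.star_lstar s hs).2 _ trivial).2 (T.star_idem s hs)

theorem bar_and_f_of_mem {s : S} (hs : s ∈ S0) : T.bar s = s ∧ T.f s = T.star s := by
  have h := T.unique s trivial s hs (T.plus s) trivial (T.star s) trivial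
    (T.plus_idem s hs) (T.star_idem s hs)
    (by simp only [mulOf]; rw [T.plus_mul hs, T.mul_star hs])
    ⟨.inl rfl, .inl rfl⟩ ⟨.inl rfl, .inl rfl⟩
  exact ⟨h.1.symm, h.2.2.symm⟩

theorem e_mul_bar (hS : LeftAdequateOn (mulOf S) Set.univ) (x : S) :
    T.e x * T.bar x = x := by
  have hb := T.bar_mem x trivial
  have hg := (T.f_greenR x trivial).mul_eq (T.f_idem x trivial) (T.star_idem _ hb)
  have hf : T.f x = T.star (T.bar x) :=
    hS.2 _ trivial _ trivial (T.f_idem x trivial) (T.star_idem _ hb)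
      (RStarOn.of_mul_eq hg.1 hg.2)
  have hd : x = T.e x * T.bar x * T.f x := T.decomp x trivial
  rw [hf, mul_assoc, T.mul_star hb] at hd
  exact hd.symm

theorem bar_mul_f (hS : RightAdequateOn (mulOf S) Set.univ) (x : S) :
    T.bar x * T.f x = x := by
  have hb := T.bar_mem x trivial
  have hg := (T.e_greenL x trivial).mul_eq (T.e_idem x trivial) (T.plus_idem _ hb)
  have he : T.e x = T.plus (T.bar x) :=
    hS.2 _ trivial _ trivial (T.e_idem x trivial) (T.plus_idem _ hb)
      (LStarOn.of_mul_eq hg.1 hg.2)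
  have hd : x = T.e x * T.bar x * T.f x := T.decomp x trivial
  rw [he, T.plus_mul hb] at hd
  exact hd.symm

theorem f_mul_star_bar (x : S) : T.f x * T.star (T.bar x) = T.star (T.bar x) :=
  ((T.f_greenR x trivial).mul_eq (T.f_idem x trivial)
    (T.star_idem _ (T.bar_mem x trivial))).1

end AdequateTransversalOn

end Semigroup

end Paper

open Paper in
/-- **Lemma `ET-lemma`.** `E(T) = {(x,a) ∈ T : x̄ = a∗x}`. -/
theorem stmt13 {L R G : Type u} [Semigroup L] [Semigroup R] [Semigroup G]
    (jL : G → L) (jR : G → R)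
    (hjL : Function.Injective jL) (hjR : Function.Injective jR)
    (hjLm : ∀ s t : G, jL (s * t) = jL s * jL t)
    (hjRm : ∀ s t : G, jR (s * t) = jR s * jR t)
    (hG : AdequateOn (mulOf G) Set.univ)
    (hL : LeftAdequateOn (mulOf L) Set.univ)
    (hR : RightAdequateOn (mulOf R) Set.univ)
    (TL : AdequateTransversalOn (mulOf L) Set.univ (Set.range jL))
    (TR : AdequateTransversalOn (mulOf R) Set.univ (Set.range jR))
    (hQL : QuasiIdealOn (mulOf L) Set.univ (Set.range jL))
    (hQR : QuasiIdealOn (mulOf R) Set.univ (Set.range jR))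
    (st : R → L → G)
    (cond1 : ∀ (y z : L) (a b : R),
      (∃ s : G, jL s = TL.bar y ∧ jR s = TR.bar b) →
      st (jR (st a y) * TR.f b) z = st a (TL.e y * jL (st b z)))
    (cond2L : ∀ (s : G) (x : L), jL (st (jR s) x) = jL s * x)
    (cond2R : ∀ (a : R) (s : G), jR (st a (jL s)) = a * jR s)
    :
    {p | p ∈ absTset TL TR ∧ Idem (absMul TL TR st) p} =
      {p | p ∈ absTset TL TR ∧ TL.bar p.1 = jL (st p.2 p.1)} := by
  ext ⟨x, a⟩
  refine and_congr_right fun hT => ?_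
  obtain ⟨s, hsL, hsR⟩ := hT
  have hx : TL.e x * jL s = x := by rw [hsL]; exact TL.e_mul_bar hL x
  have ha : jR s * TR.f a = a := by rw [hsR]; exact TR.bar_mul_f hR a
  have hI : Idem (absMul TL TR st) (x, a) ↔
      TL.e x * jL (st a x) = x ∧ jR (st a x) * TR.f a = a := Prod.mk_inj
  change _ ↔ TL.bar x = jL (st a x)
  rw [hI]
  constructor
  · rintro ⟨-, hta⟩
    have hs : jR s ∈ Set.range jR := ⟨s, rfl⟩
    obtain ⟨hbar, hf⟩ := TR.bar_and_f_of_mem hs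
    obtain ⟨u, hu⟩ := TR.star_mem _ hs
    have hss := TR.mul_star hs
    have hfs : TR.f a * TR.star (jR s) = TR.star (jR s) := by
      rw [hsR]; exact TR.f_mul_star_bar a
    have hts : jR (st a x) * TR.star (jR s) = jR s := by
      rw [← hfs, ← mul_assoc, hta]
      nth_rw 1 [← ha]
      rw [mul_assoc, hfs, hss]
    have hsu : st (jR s) (jL u) = s := hjR <| by rw [cond2R, hu, hss]
    have h := cond1 x (jL u) a (jR s) ⟨s, hsL, hbar.symm⟩
    rw [hf, hts, hsu, hx] at h
    rw [← h, hsL]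
  · intro h
    have hst : st a x = s := hjL (h.symm.trans hsL.symm)
    rw [hst]
    exact ⟨hx, ha⟩
end

section
/- Let S⁰ be an adequate semigroup with semilattice of idempotents E⁰, L a left adequate semigroup and R a right adequate semigroup such that S⁰ is a quasi-ideal adequate transversal of both L and R, and let ∗ : R × L → S⁰ satisfy conditions (1), (2) and (3): e∗f ∈ E⁰ for all e ∈ E(R), f ∈ E(L). Then S⁰ is in fact a multiplicative adequate transversal of both L and R, i.e. λi ∈ E⁰ for all λ ∈ Λ(R), i ∈ I(R), and λ'i' ∈ E⁰ for all λ' ∈ Λ(L), i' ∈ I(L). -/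
namespace Paper

theorem GreenLOn.lStarOn {S : Type*} [Semigroup S] {a b : S}
    (h : GreenLOn (mulOf S) Set.univ a b) : LStarOn (mulOf S) Set.univ a b := by
  obtain ⟨rfl | ⟨u, -, hu⟩, h⟩ := h
  · exact ⟨fun _ _ _ _ => Iff.rfl, fun _ _ => Iff.rfl⟩
  obtain rfl | ⟨v, -, hv⟩ := h
  · exact ⟨fun _ _ _ _ => Iff.rfl, fun _ _ => Iff.rfl⟩
  · simp only [mulOf] at hu hv
    have hab : ∀ x, a * x = u * (b * x) := fun x => by rw [← mul_assoc, hu]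
    have hba : ∀ x, b * x = v * (a * x) := fun x => by rw [← mul_assoc, hv]
    refine ⟨fun x _ y _ => ⟨fun h => ?_, fun h => ?_⟩, fun x _ => ⟨fun h => ?_, fun h => ?_⟩⟩ <;>
      simp only [mulOf] at h ⊢
    · rw [hba, h, ← hba]
    · rw [hab, h, ← hab]
    · rw [hba, h, hv]
    · rw [hab, h, hu]

theorem GreenROn.rStarOn {S : Type*} [Semigroup S] {a b : S}
    (h : GreenROn (mulOf S) Set.univ a b) : RStarOn (mulOf S) Set.univ a b := by
  obtain ⟨rfl | ⟨u, -, hu⟩, h⟩ := h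
  · exact ⟨fun _ _ _ _ => Iff.rfl, fun _ _ => Iff.rfl⟩
  obtain rfl | ⟨v, -, hv⟩ := h
  · exact ⟨fun _ _ _ _ => Iff.rfl, fun _ _ => Iff.rfl⟩
  · simp only [mulOf] at hu hv
    have hab : ∀ x, x * a = x * b * u := fun x => by rw [mul_assoc, hu]
    have hba : ∀ x, x * b = x * a * v := fun x => by rw [mul_assoc, hv]
    refine ⟨fun x _ y _ => ⟨fun h => ?_, fun h => ?_⟩, fun x _ => ⟨fun h => ?_, fun h => ?_⟩⟩ <;>
      simp only [mulOf] at h ⊢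
    · rw [hba, h, ← hba]
    · rw [hab, h, ← hab]
    · rw [hba, h, hv]
    · rw [hab, h, hu]

namespace AdequateTransversalOn

variable {S : Type*} [Semigroup S] {S0 : Set S}

/-- In a right adequate semigroup, `e_x` lies in the transversal. -/
theorem e_mem_of_rightAdequateOn (T : AdequateTransversalOn (mulOf S) Set.univ S0)
    (hS : RightAdequateOn (mulOf S) Set.univ) (x : S) : T.e x ∈ S0 := by
  have hx := T.bar_mem x trivial
  rw [hS.2 _ trivial _ trivial (T.e_idem x trivial) (T.plus_idem _ hx)
    (T.e_greenL x trivial).lStarOn]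
  exact T.plus_mem _ hx

/-- In a left adequate semigroup, `f_x` lies in the transversal. -/
theorem f_mem_of_leftAdequateOn (T : AdequateTransversalOn (mulOf S) Set.univ S0)
    (hS : LeftAdequateOn (mulOf S) Set.univ) (x : S) : T.f x ∈ S0 := by
  have hx := T.bar_mem x trivial
  rw [hS.2 _ trivial _ trivial (T.f_idem x trivial) (T.star_idem _ hx)
    (T.f_greenR x trivial).rStarOn]
  exact T.star_mem _ hx

end AdequateTransversalOn

/-- An injective multiplicative map preserves and reflects idempotents. -/
theorem idem_map_iff {G S : Type*} [Semigroup G] [Semigroup S] {j : G → S}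
    (hj : Function.Injective j) (hjm : ∀ s t, j (s * t) = j s * j t) {s : G} :
    Idem (mulOf S) (j s) ↔ Idem (mulOf G) s := by
  simp only [Idem, mulOf, ← hjm, hj.eq_iff]

end Paper

open Paper in
/-- If moreover (3) `e∗f ∈ E⁰` for all `e ∈ E(R)`, `f ∈ E(L)`,
then `S⁰` is in fact a *multiplicative* transversal of both `L` and `R`:
`Λ(R)I(R) ⊆ E⁰` and `Λ(L)I(L) ⊆ E⁰`. -/
theorem stmt16 {L R G : Type u} [Semigroup L] [Semigroup R] [Semigroup G]
    (jL : G → L) (jR : G → R)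
    (hjL : Function.Injective jL) (hjR : Function.Injective jR)
    (hjLm : ∀ s t : G, jL (s * t) = jL s * jL t)
    (hjRm : ∀ s t : G, jR (s * t) = jR s * jR t)
    (hG : AdequateOn (mulOf G) Set.univ)
    (hL : LeftAdequateOn (mulOf L) Set.univ)
    (hR : RightAdequateOn (mulOf R) Set.univ)
    (TL : AdequateTransversalOn (mulOf L) Set.univ (Set.range jL))
    (TR : AdequateTransversalOn (mulOf R) Set.univ (Set.range jR))
    (hQL : QuasiIdealOn (mulOf L) Set.univ (Set.range jL))
    (hQR : QuasiIdealOn (mulOf R) Set.univ (Set.range jR))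
    (st : R → L → G)
    (cond1 : ∀ (y z : L) (a b : R),
      (∃ s : G, jL s = TL.bar y ∧ jR s = TR.bar b) →
      st (jR (st a y) * TR.f b) z = st a (TL.e y * jL (st b z)))
    (cond2L : ∀ (s : G) (x : L), jL (st (jR s) x) = jL s * x)
    (cond2R : ∀ (a : R) (s : G), jR (st a (jL s)) = a * jR s)
    (cond3 : ∀ (e : R) (f : L), Idem (mulOf R) e → Idem (mulOf L) f →
      Idem (mulOf G) (st e f)) :
    TR.IsMultiplicative ∧ TL.IsMultiplicative := by
  constructor
  · rintro _ ⟨x, -, rfl⟩ _ ⟨y, -, rfl⟩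
    obtain ⟨s, hs⟩ := TR.e_mem_of_rightAdequateOn hR y
    have hi := TR.e_idem y trivial
    rw [← hs] at hi ⊢
    have h : mulOf R (TR.f x) (jR s) = jR (st (TR.f x) (jL s)) := (cond2R _ _).symm
    rw [h, idem_map_iff hjR hjRm]
    exact ⟨⟨_, rfl⟩, cond3 _ _ (TR.f_idem x trivial)
      ((idem_map_iff hjL hjLm).2 ((idem_map_iff hjR hjRm).1 hi))⟩
  · rintro _ ⟨x, -, rfl⟩ _ ⟨y, -, rfl⟩
    obtain ⟨s, hs⟩ := TL.f_mem_of_leftAdequateOn hL x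
    have hi := TL.f_idem x trivial
    rw [← hs] at hi ⊢
    have h : mulOf L (jL s) (TL.e y) = jL (st (jR s) (TL.e y)) := (cond2L _ _).symm
    rw [h, idem_map_iff hjL hjLm]
    exact ⟨⟨_, rfl⟩, cond3 _ _ ((idem_map_iff hjR hjRm).2 ((idem_map_iff hjL hjLm).1 hi))
      (TL.e_idem y trivial)⟩
end
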